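/- arXiv:1110.3427 — 2 statements merged into one kernel-verified Lean document; each statement's English description precedes it below -/
import Mathlib

section
/- Let (R,m) be a Noetherian local ring, M a finitely generated R-module, and b ⊆ m an ideal of R. Then there exists an integer μ₀ ≥ 0 such that depth(m, b^μ M) > 0 for all μ ≥ μ₀ (with the convention that the depth of the zero module is ∞); equivalently, for all μ ≥ μ₀ the maximal ideal m is not an associated prime of b^μ M unless b^μ M = 0. -/
open IsLocalRing

/-- `seqDepth a M` is the depth of the `R`-module `M` with respect to the ideal `a`: the
supremum of the lengths of `M`-regular sequences contained in `a`, with the convention that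
the depth of the zero module is `∞`. -/
noncomputable def seqDepth {R : Type*} [CommRing R] (a : Ideal R) (M : Type*)
    [AddCommGroup M] [Module R M] : ℕ∞ :=
  haveI := Classical.propDecidable (Subsingleton M)
  if Subsingleton M then ⊤
  else sSup {n : ℕ∞ | ∃ rs : List R, (rs.length : ℕ∞) = n ∧ (∀ r ∈ rs, r ∈ a) ∧
    RingTheory.Sequence.IsRegular M rs}

/-- **Herzog's Lemma.**  Let `(R,𝔪)` be a Noetherian local ring, `M` a finitely generated
`R`-module and `b ⊆ 𝔪` an ideal.  Then there is `μ₀ ≥ 0` such that `depth(𝔪, bᵘ M) > 0` for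
all `μ ≥ μ₀` (with the convention that the zero module has depth `∞`). -/
theorem herzog_depth_lemma {R : Type*} [CommRing R] [IsNoetherianRing R] [IsLocalRing R]
    (M : Type*) [AddCommGroup M] [Module R M] [Module.Finite R M]
    (b : Ideal R) (hb : b ≤ maximalIdeal R) :
    ∃ μ₀ : ℕ, ∀ μ ≥ μ₀, 0 < seqDepth (maximalIdeal R) ↥(b ^ μ • (⊤ : Submodule R M)) := by
  classical
  set S : Submodule R M := Submodule.torsionBySet R M (maximalIdeal R : Set R) with hS
  obtain ⟨k, hk⟩ := Ideal.exists_pow_inf_eq_pow_smul b S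
  refine ⟨k + 1, fun μ hμ => ?_⟩
  -- the socle of `M` meets `b ^ μ M` trivially
  have key : b ^ μ • (⊤ : Submodule R M) ⊓ S = ⊥ := by
    rw [hk μ (by omega), eq_bot_iff, Submodule.smul_le]
    intro r hr n hn
    have hr' : r ∈ maximalIdeal R := hb (Ideal.pow_le_self (by omega) hr)
    have hnS : n ∈ S := hn.2
    rw [hS, Submodule.mem_torsionBySet_iff] at hnS
    simpa using hnS ⟨r, hr'⟩
  unfold seqDepth
  split_ifs with hsub
  · simp
  have : Nontrivial ↥(b ^ μ • (⊤ : Submodule R M)) := not_subsingleton_iff_nontrivial.mp hsub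
  generalize hN : b ^ μ • (⊤ : Submodule R M) = N at *
  -- there is a regular element in the maximal ideal
  obtain ⟨r, hr, hreg⟩ : ∃ r ∈ maximalIdeal R, IsSMulRegular N r := by
    by_contra! hcon
    have hsubset : (maximalIdeal R : Set R) ⊆ ⋃ p ∈ associatedPrimes R N, p := by
      rw [biUnion_associatedPrimes_eq_compl_regular]
      exact fun r hr => hcon r hr
    obtain ⟨P, hP, hle⟩ : ∃ P ∈ associatedPrimes R N, maximalIdeal R ≤ P :=
      ((maximalIdeal R).subset_union_prime_finite (associatedPrimes.finite R N)
        (f := id) 0 0 fun _ h _ _ => h.1).1 hsubset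
    obtain ⟨hprime, x, hx⟩ := isAssociatedPrime_iff.mp hP
    have hxS : (x : M) ∈ S := by
      rw [hS, Submodule.mem_torsionBySet_iff]
      rintro ⟨a, ha⟩
      have h1 : a ∈ P := hle ha
      rw [hx, Submodule.mem_colon_singleton, Submodule.mem_bot] at h1
      simpa using congrArg Subtype.val h1
    have hx0 : (x : M) ∈ N ⊓ S := ⟨x.2, hxS⟩
    rw [key, Submodule.mem_bot] at hx0
    have hx1 : x = 0 := Subtype.ext hx0
    apply hprime.ne_top
    rw [hx, hx1]
    ext a
    simp [Submodule.mem_colon_singleton]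
  refine lt_of_lt_of_le (b := (1 : ℕ∞)) (by simp) (le_sSup ⟨[r], by simp, by simpa using hr, ?_⟩)
  rw [IsLocalRing.isRegular_iff_isWeaklyRegular_of_subset_maximalIdeal (by simpa using hr),
    RingTheory.Sequence.isWeaklyRegular_singleton_iff]
  exact hreg
end

section
/- Let (R,m) be a Noetherian local ring with embedding dimension e = dim_{R/m}(m/m²) and let φ be a local self-map of R. Then φ is contracting if and only if φ^e(m)R ⊆ m². -/
open IsLocalRing

/-- A local self-map `φ` of a local ring `(R,𝔪)` is *contracting* if for every `x ∈ 𝔪` the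
sequence `φⁿ(x)` converges to `0` in the `𝔪`-adic topology. -/
def Contracting {R : Type*} [CommRing R] [IsLocalRing R] (φ : R →+* R) : Prop :=
  ∀ x ∈ maximalIdeal R, ∀ k : ℕ, ∃ N : ℕ, ∀ n ≥ N, (φ ^ n) x ∈ maximalIdeal R ^ k

section Helpers

variable {R : Type*} [CommRing R] [IsLocalRing R]

lemma helper_map_pow_mem (φ : R →+* R) (hφ : ∀ x ∈ maximalIdeal R, φ x ∈ maximalIdeal R)
    (n k : ℕ) (x : R) (hx : x ∈ maximalIdeal R ^ k) : (φ ^ n) x ∈ maximalIdeal R ^ k := by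
  have h1 : (maximalIdeal R).map φ ≤ maximalIdeal R := Ideal.map_le_iff_le_comap.2 hφ
  have h2 : ∀ y ∈ maximalIdeal R ^ k, φ y ∈ maximalIdeal R ^ k := fun y hy => by
    have h3 := Ideal.mem_map_of_mem φ hy
    rw [Ideal.map_pow] at h3
    exact Ideal.pow_right_mono h1 k h3
  induction n with
  | zero => simpa using hx
  | succ n ih => rw [pow_succ' φ]; exact h2 _ ih

/-- The kernel of the `n`-th iterate of the map induced on the cotangent space. -/
def helperKer (φ : R →+* R) (hφ : ∀ x ∈ maximalIdeal R, φ x ∈ maximalIdeal R) (n : ℕ) :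
    Submodule (ResidueField R) (CotangentSpace R) where
  carrier := {v | ∃ x : maximalIdeal R, (maximalIdeal R).toCotangent x = v ∧
    (φ ^ n) (x : R) ∈ maximalIdeal R ^ 2}
  zero_mem' := ⟨0, by simp, by simp⟩
  add_mem' := by
    rintro _ _ ⟨x, rfl, hx⟩ ⟨y, rfl, hy⟩
    exact ⟨x + y, by simp, by simpa using add_mem hx hy⟩
  smul_mem' := by
    rintro c _ ⟨x, rfl, hx⟩
    obtain ⟨r, rfl⟩ := IsLocalRing.residue_surjective c
    refine ⟨r • x, ?_, ?_⟩
    · rw [map_smul]; rfl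
    · simpa using Ideal.mul_mem_left _ _ hx

lemma mem_helperKer (φ : R →+* R) (hφ : ∀ x ∈ maximalIdeal R, φ x ∈ maximalIdeal R) (n : ℕ)
    (x : maximalIdeal R) :
    (maximalIdeal R).toCotangent x ∈ helperKer φ hφ n ↔ (φ ^ n) (x : R) ∈ maximalIdeal R ^ 2 := by
  constructor
  · rintro ⟨y, hy, h⟩
    rw [Ideal.toCotangent_eq] at hy
    have h2 := helper_map_pow_mem φ hφ n 2 _ hy
    rw [map_sub] at h2
    have h3 := sub_mem h h2
    simpa using h3
  · exact fun h => ⟨x, rfl, h⟩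

lemma helperKer_le_succ (φ : R →+* R) (hφ : ∀ x ∈ maximalIdeal R, φ x ∈ maximalIdeal R) (n : ℕ) :
    helperKer φ hφ n ≤ helperKer φ hφ (n + 1) := by
  rintro _ ⟨x, rfl, hx⟩
  refine ⟨x, rfl, ?_⟩
  rw [pow_succ' φ]
  have h := helper_map_pow_mem φ hφ 1 2 _ hx
  rw [pow_one] at h
  exact h

lemma helperKer_stable (φ : R →+* R) (hφ : ∀ x ∈ maximalIdeal R, φ x ∈ maximalIdeal R) (n : ℕ)
    (h : helperKer φ hφ n = helperKer φ hφ (n + 1)) :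
    helperKer φ hφ (n + 1) = helperKer φ hφ (n + 2) := by
  refine le_antisymm (helperKer_le_succ φ hφ _) ?_
  rintro _ ⟨x, rfl, hx⟩
  refine ⟨x, rfl, ?_⟩
  have h1 : (maximalIdeal R).toCotangent ⟨φ x, hφ _ x.2⟩ ∈ helperKer φ hφ (n + 1) := by
    rw [mem_helperKer]
    rw [show n + 2 = (n + 1) + 1 from rfl, pow_succ φ] at hx
    exact hx
  rw [← h, mem_helperKer] at h1
  rw [pow_succ φ]
  exact h1

lemma helperKer_top [IsNoetherianRing R] (φ : R →+* R)
    (hφ : ∀ x ∈ maximalIdeal R, φ x ∈ maximalIdeal R) (n : ℕ) :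
    helperKer φ hφ n ≤
      helperKer φ hφ (Module.finrank (ResidueField R) (CotangentSpace R)) := by
  have key : ∀ n, n ≤ Module.finrank (ResidueField R) (helperKer φ hφ n) ∨
      helperKer φ hφ n = helperKer φ hφ (n + 1) := by
    intro n
    induction n with
    | zero => left; simp
    | succ n ih =>
      by_cases h : helperKer φ hφ n = helperKer φ hφ (n + 1)
      · exact Or.inr (helperKer_stable φ hφ n h)
      · left
        have := Submodule.finrank_lt_finrank_of_lt (lt_of_le_of_ne (helperKer_le_succ φ hφ n) h)
        have := ih.resolve_right h
        omega
  rcases key (Module.finrank (ResidueField R) (CotangentSpace R)) with h | h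
  · rw [Submodule.eq_top_of_finrank_eq (le_antisymm (Submodule.finrank_le _) h)]
    exact le_top
  · generalize Module.finrank (ResidueField R) (CotangentSpace R) = e at h
    have hst : ∀ j, helperKer φ hφ (e + j) = helperKer φ hφ (e + j + 1) := by
      intro j
      induction j with
      | zero => exact h
      | succ j ih => exact helperKer_stable φ hφ _ ih
    have hst2 : ∀ j, helperKer φ hφ (e + j) = helperKer φ hφ e := by
      intro j
      induction j with
      | zero => rfl
      | succ j ih => rw [← ih]; exact (hst j).symm
    have mono := monotone_nat_of_le_succ (helperKer_le_succ φ hφ)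
    rw [← hst2 n]
    exact mono (by omega)

end Helpers

/-- **Characterization of contracting self-maps** (Avramov–Iyengar–Miller).  A local self-map
`φ` of a Noetherian local ring `(R,𝔪)` is contracting if and only if `φᵉ(𝔪)R ⊆ 𝔪²`, where
`e = dim_{R/𝔪}(𝔪/𝔪²)` is the embedding dimension of `R`. -/
theorem contracting_iff_pow_embDim {R : Type*} [CommRing R] [IsNoetherianRing R] [IsLocalRing R]
    (φ : R →+* R) (hloc : IsLocalHom φ) :
    Contracting φ ↔
      Ideal.map (φ ^ Module.finrank (ResidueField R) (CotangentSpace R)) (maximalIdeal R) ≤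
        maximalIdeal R ^ 2 := by
  have hφ : ∀ x ∈ maximalIdeal R, φ x ∈ maximalIdeal R := fun x hx =>
    (map_mem_nonunits_iff φ x).2 hx
  constructor
  · intro hc
    rw [Ideal.map_le_iff_le_comap]
    intro x hx
    obtain ⟨N, hN⟩ := hc x hx 2
    exact (mem_helperKer φ hφ _ ⟨x, hx⟩).1
      (helperKer_top φ hφ N ((mem_helperKer φ hφ N ⟨x, hx⟩).2 (hN N le_rfl)))
  · intro h
    generalize Module.finrank (ResidueField R) (CotangentSpace R) = e at h
    have hk : ∀ k, ∀ x ∈ maximalIdeal R, (φ ^ (e * k)) x ∈ maximalIdeal R ^ (k + 1) := by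
      intro k
      induction k with
      | zero => intro x hx; simpa using hx
      | succ k ih =>
        intro x hx
        have h1 := Ideal.mem_map_of_mem (φ ^ e) (ih x hx)
        rw [Ideal.map_pow] at h1
        have h2 := Ideal.pow_right_mono h (k + 1) h1
        rw [← pow_mul] at h2
        rw [show e * (k + 1) = e + e * k by ring, pow_add φ]
        exact Ideal.pow_le_pow_right (show k + 1 + 1 ≤ 2 * (k + 1) by omega) h2
    intro x hx k
    refine ⟨e * k, fun n hn => ?_⟩
    obtain ⟨j, rfl⟩ := Nat.exists_eq_add_of_le hn
    rw [add_comm, pow_add φ]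
    exact helper_map_pow_mem φ hφ j k _ (Ideal.pow_le_pow_right (by omega) (hk k x hx))
end
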